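/- arXiv:1610.01555 — 2 statements merged into one kernel-verified Lean document; each statement's English description precedes it below -/
import Mathlib

section
/- For a strip of triangles △̄ of n triangles, the subspaces of S(△̄) with boundary conditions satisfy: dim S(:△̄) = dim S(△̄:) = n and dim S(:△̄:) = n−2 (the last when n ≥ 2). -/
open scoped Classical

noncomputable section

/-- Points of the plane. -/
abbrev E : Type := ℝ × ℝ

/-- The closed triangle `Δᵢ` with vertices `V i`, `V (i+1)`, `V (i+2)`. -/
def tri (V : ℕ → E) (i : ℕ) : Set E :=
  convexHull ℝ {V i, V (i + 1), V (i + 2)}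

/-- `V 1, …, V (n+2)` are the vertices of a strip of `n` triangles
`Δ₁, …, Δₙ`, where `Δᵢ = [Vᵢ, Vᵢ₊₁, Vᵢ₊₂]`. -/
structure IsStrip (n : ℕ) (V : ℕ → E) : Prop where
  indep : ∀ i, 1 ≤ i → i ≤ n → AffineIndependent ℝ ![V i, V (i + 1), V (i + 2)]
  adj : ∀ i, 1 ≤ i → i + 1 ≤ n →
    tri V i ∩ tri V (i + 1) = segment ℝ (V (i + 1)) (V (i + 2))
  touch : ∀ i, 1 ≤ i → i + 2 ≤ n → tri V i ∩ tri V (i + 2) = {V (i + 2)}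
  disj : ∀ i j, 1 ≤ i → j ≤ n → i + 3 ≤ j → tri V i ∩ tri V j = ∅

/-- The underlying set `|△̄ₖᵐ|` of the (sub)strip consisting of the triangles
`Δ k, …, Δ m`. -/
def stripSet (V : ℕ → E) (k m : ℕ) : Set E :=
  ⋃ i ∈ Finset.Icc k m, tri V i

/-- The space `S(△̄ₖᵐ)` of continuous functions on the strip `|△̄ₖᵐ|` whose
restriction to each triangle `Δᵢ`, `k ≤ i ≤ m`, agrees with an affine
function `ℝ² → ℝ`. -/
def stripSpace (V : ℕ → E) (k m : ℕ) : Submodule ℝ (stripSet V k m → ℝ) where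
  carrier := {s | Continuous s ∧ ∀ i ∈ Finset.Icc k m, ∃ f : E →ᵃ[ℝ] ℝ,
    ∀ x : stripSet V k m, (x : E) ∈ tri V i → s x = f x}
  add_mem' := by
    rintro a b ⟨hca, ha⟩ ⟨hcb, hb⟩
    refine ⟨hca.add hcb, fun i hi => ?_⟩
    obtain ⟨f, hf⟩ := ha i hi
    obtain ⟨g, hg⟩ := hb i hi
    exact ⟨f + g, fun x hx => by simp [hf x hx, hg x hx]⟩
  zero_mem' := ⟨continuous_const, fun i hi => ⟨0, fun x hx => by simp⟩⟩
  smul_mem' := by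
    rintro c a ⟨hca, ha⟩
    refine ⟨hca.const_smul c, fun i hi => ?_⟩
    obtain ⟨f, hf⟩ := ha i hi
    exact ⟨c • f, fun x hx => by simp [hf x hx]⟩

/-- Poisedness of a node set `A` for a subspace `T` of the functions on the
strip `|△̄ₖᵐ|`: for every data `c` there is a unique `s ∈ T` interpolating
`c` at the nodes. -/
def PoisedFor (V : ℕ → E) (k m : ℕ) (T : Submodule ℝ (stripSet V k m → ℝ))
    (A : Finset E) : Prop :=
  ∀ c : E → ℝ, ∃! s : stripSet V k m → ℝ,
    s ∈ T ∧ ∀ a : stripSet V k m, (a : E) ∈ A → s a = c a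

/-- Poisedness of the interpolation problem `{△̄ₖᵐ, A}`. -/
def Poised (V : ℕ → E) (k m : ℕ) (A : Finset E) : Prop :=
  PoisedFor V k m (stripSpace V k m) A

/-- The node set `Aₖᵐ = A ∩ |△̄ₖᵐ|` of the subproblem `{△̄, A}ₖᵐ`. -/
def nodesIn (V : ℕ → E) (k m : ℕ) (A : Finset E) : Finset E :=
  A.filter (fun x => x ∈ stripSet V k m)

/-- The nodes of `A` lying in the triangle `Δᵢ`. -/
def triNodes (V : ℕ → E) (i : ℕ) (A : Finset E) : Finset E :=
  A.filter (fun x => x ∈ tri V i)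
/-- The subspace of functions on the strip `|△̄ₖᵐ|` vanishing on the set `D`. -/
def vanishOn (V : ℕ → E) (k m : ℕ) (D : Set E) :
    Submodule ℝ (stripSet V k m → ℝ) where
  carrier := {s | ∀ x : stripSet V k m, (x : E) ∈ D → s x = 0}
  add_mem' := fun ha hb x hx => by simp [ha x hx, hb x hx]
  zero_mem' := fun x hx => rfl
  smul_mem' := fun c a ha x hx => by simp [ha x hx]

/-- Existence of a fundamental function for the node `a` of the node set `A`:
a function `s ∈ S(△̄ₖᵐ)` with `s(a) = 1` and `s = 0` at all other nodes. -/
def HasFund (V : ℕ → E) (k m : ℕ) (A : Finset E) (a : E) : Prop :=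
  ∃ s ∈ stripSpace V k m,
    (∀ x : stripSet V k m, (x : E) = a → s x = 1) ∧
    (∀ x : stripSet V k m, (x : E) ∈ A → (x : E) ≠ a → s x = 0)

/-- The boundary (the union of the three sides) of the triangle `Δᵢ`. -/
def triBdry (V : ℕ → E) (i : ℕ) : Set E :=
  segment ℝ (V i) (V (i + 1)) ∪ segment ℝ (V (i + 1)) (V (i + 2)) ∪
    segment ℝ (V i) (V (i + 2))

/-- One line transformation of the node set `𝒜` into `𝒜'`: two distinct nodes
`A B` of `𝒜` lying in a triangle `Δᵢ` of the strip are replaced by the two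
points `A' ≠ B'` in which the line through `A` and `B` meets the sides of
`Δᵢ`. -/
def LineStep (n : ℕ) (V : ℕ → E) (𝒜 𝒜' : Finset E) : Prop :=
  ∃ (i : ℕ) (A B A' B' : E), 1 ≤ i ∧ i ≤ n ∧
    A ∈ 𝒜 ∧ B ∈ 𝒜 ∧ A ≠ B ∧ A ∈ tri V i ∧ B ∈ tri V i ∧
    A' ≠ B' ∧ A' ∈ affineSpan ℝ {A, B} ∧ B' ∈ affineSpan ℝ {A, B} ∧
    A' ∈ triBdry V i ∧ B' ∈ triBdry V i ∧
    𝒜' = (𝒜 \ {A, B}) ∪ {A', B'}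

lemma mem_stripSet_of_mem_tri {V : ℕ → E} {n i : ℕ} (hi : i ∈ Finset.Icc 1 n) {x : E}
    (hx : x ∈ tri V i) : x ∈ stripSet V 1 n :=
  Set.mem_biUnion (t := fun i => tri V i) (by simpa using hi) hx

lemma vertices_mem_tri (V : ℕ → E) (i : ℕ) :
    V i ∈ tri V i ∧ V (i + 1) ∈ tri V i ∧ V (i + 2) ∈ tri V i :=
  ⟨subset_convexHull ℝ _ (by simp), subset_convexHull ℝ _ (by simp),
    subset_convexHull ℝ _ (by simp)⟩

/-- Every vertex of a nonempty strip belongs to one of its triangles, as one of the corners. -/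
lemma exists_triangle_of_vertex {n j : ℕ} (hn : 1 ≤ n) (hj : j ∈ Finset.Icc 1 (n + 2)) :
    ∃ i ∈ Finset.Icc 1 n, j = i ∨ j = i + 1 ∨ j = i + 2 := by
  rw [Finset.mem_Icc] at hj
  by_cases h : j ≤ n
  · exact ⟨j, Finset.mem_Icc.2 ⟨hj.1, h⟩, Or.inl rfl⟩
  · exact ⟨n, Finset.mem_Icc.2 ⟨hn, le_rfl⟩, by omega⟩

lemma vertex_mem_stripSet (V : ℕ → E) {n j : ℕ} (hn : 1 ≤ n)
    (hj : j ∈ Finset.Icc 1 (n + 2)) : V j ∈ stripSet V 1 n := by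
  obtain ⟨i, hi, h⟩ := exists_triangle_of_vertex hn hj
  obtain ⟨h0, h1, h2⟩ := vertices_mem_tri V i
  rcases h with rfl | rfl | rfl
  · exact mem_stripSet_of_mem_tri hi h0
  · exact mem_stripSet_of_mem_tri hi h1
  · exact mem_stripSet_of_mem_tri hi h2

/-- Affine functions that agree on a set agree on its convex hull. -/
lemma affineMap_eqOn_convexHull {f g : E →ᵃ[ℝ] ℝ} {A : Set E} (h : Set.EqOn f g A) :
    Set.EqOn f g (convexHull ℝ A) := by
  have hconv : Convex ℝ ((f - g) ⁻¹' {0}) := (convex_singleton 0).affine_preimage (f - g)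
  have hsub : convexHull ℝ A ⊆ (f - g) ⁻¹' {0} :=
    convexHull_min (fun x hx => by simp [h hx]) hconv
  intro x hx
  have hx0 : f x - g x = 0 := by simpa using hsub hx
  linarith

lemma affineMap_eqOn_segment {f g : E →ᵃ[ℝ] ℝ} {a b : E} (ha : f a = g a) (hb : f b = g b) :
    Set.EqOn f g (segment ℝ a b) := by
  rw [← convexHull_pair]
  apply affineMap_eqOn_convexHull
  rintro x (rfl | rfl) <;> assumption

/-- An affine function on the plane interpolating arbitrary data at the corners of a
nondegenerate triangle. -/
lemma exists_affineMap_interpolating {p : Fin 3 → E} (hp : AffineIndependent ℝ p)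
    (c : Fin 3 → ℝ) : ∃ f : E →ᵃ[ℝ] ℝ, ∀ k, f (p k) = c k := by
  have htop : affineSpan ℝ (Set.range p) = ⊤ := by
    rw [hp.affineSpan_eq_top_iff_card_eq_finrank_add_one]
    simp
  let b : AffineBasis (Fin 3) ℝ E := ⟨p, hp, htop⟩
  refine ⟨∑ i, c i • b.coord i, fun k => ?_⟩
  have hbk : ∀ i, b.coord i (p k) = if i = k then 1 else 0 := fun i => b.coord_apply i k
  have hsum : (∑ i, c i • b.coord i) (p k) = ∑ i, c i * b.coord i (p k) := by
    simp [Fin.sum_univ_three]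
  rw [hsum]
  simp [hbk]

/-- Affine pieces with prescribed values at the corners agree where triangles meet. -/
lemma IsStrip.pieces_agree {n : ℕ} {V : ℕ → E} (hV : IsStrip n V) {c : ℕ → ℝ}
    {f : ℕ → E →ᵃ[ℝ] ℝ}
    (hf : ∀ i ∈ Finset.Icc 1 n, f i (V i) = c i ∧ f i (V (i + 1)) = c (i + 1) ∧
      f i (V (i + 2)) = c (i + 2))
    {i j : ℕ} (hi : i ∈ Finset.Icc 1 n) (hj : j ∈ Finset.Icc 1 n) {x : E}
    (hxi : x ∈ tri V i) (hxj : x ∈ tri V j) : f i x = f j x := by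
  wlog hij : i ≤ j generalizing i j
  · exact (this hj hi hxj hxi (by omega)).symm
  obtain ⟨a0, a1, a2⟩ := hf i hi
  obtain ⟨b0, b1, b2⟩ := hf j hj
  rw [Finset.mem_Icc] at hi hj
  have hx : x ∈ tri V i ∩ tri V j := ⟨hxi, hxj⟩
  obtain rfl | rfl | rfl | h : j = i ∨ j = i + 1 ∨ j = i + 2 ∨ i + 3 ≤ j := by omega
  · rfl
  · rw [hV.adj i hi.1 hj.2] at hx
    exact affineMap_eqOn_segment (a1.trans b0.symm) (a2.trans b1.symm) hx
  · rw [hV.touch i hi.1 hj.2] at hx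
    rw [Set.mem_singleton_iff.1 hx, a2, b0]
  · rw [hV.disj i j hi.1 hj.2 h] at hx
    exact hx.elim

/-- Functions in the strip space interpolate arbitrary data at the vertices. -/
lemma IsStrip.exists_interpolating {n : ℕ} (hn : 1 ≤ n) {V : ℕ → E} (hV : IsStrip n V)
    (c : ℕ → ℝ) : ∃ s ∈ stripSpace V 1 n, ∀ j (hj : j ∈ Finset.Icc 1 (n + 2)),
      s ⟨V j, vertex_mem_stripSet V hn hj⟩ = c j := by
  have hex : ∀ i, ∃ f : E →ᵃ[ℝ] ℝ, i ∈ Finset.Icc 1 n → f (V i) = c i ∧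
      f (V (i + 1)) = c (i + 1) ∧ f (V (i + 2)) = c (i + 2) := by
    intro i
    by_cases hi : i ∈ Finset.Icc 1 n
    · have hi' := Finset.mem_Icc.1 hi
      obtain ⟨f, hf⟩ := exists_affineMap_interpolating (hV.indep i hi'.1 hi'.2)
        ![c i, c (i + 1), c (i + 2)]
      exact ⟨f, fun _ => ⟨hf 0, hf 1, hf 2⟩⟩
    · exact ⟨0, fun h => absurd h hi⟩
  choose f hf using hex
  have hcover : ∀ x : stripSet V 1 n, ∃ i ∈ Finset.Icc 1 n, (x : E) ∈ tri V i := by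
    intro x
    simpa only [stripSet, Set.mem_iUnion, exists_prop] using x.2
  choose idx hidx hmem using hcover
  let s : stripSet V 1 n → ℝ := fun x => f (idx x) x
  have hs : ∀ i ∈ Finset.Icc 1 n, ∀ x : stripSet V 1 n, (x : E) ∈ tri V i → s x = f i x :=
    fun i hi x hx => hV.pieces_agree hf (hidx x) hi (hmem x) hx
  have hcont : Continuous s := by
    refine (locallyFinite_of_finite
      (fun i : Finset.Icc 1 n => {x : stripSet V 1 n | (x : E) ∈ tri V i})).continuous ?_ ?_ ?_
    · exact Set.eq_univ_of_forall fun x => Set.mem_iUnion.2 ⟨⟨idx x, hidx x⟩, hmem x⟩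
    · intro i
      have hfin : ({V i, V (i + 1), V (i + 2)} : Set E).Finite := Set.toFinite _
      exact (hfin.isClosed_convexHull ℝ).preimage continuous_subtype_val
    · intro i
      refine ContinuousOn.congr (f := fun x : stripSet V 1 n => f i x) ?_ (hs i i.2)
      exact ((f i).continuous_of_finiteDimensional.comp continuous_subtype_val).continuousOn
  refine ⟨s, ⟨hcont, fun i hi => ⟨f i, hs i hi⟩⟩, fun j hj => ?_⟩
  obtain ⟨i, hi, h⟩ := exists_triangle_of_vertex hn hj
  obtain ⟨h0, h1, h2⟩ := vertices_mem_tri V i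
  obtain ⟨a0, a1, a2⟩ := hf i hi
  rcases h with rfl | rfl | rfl
  · rw [hs _ hi _ h0, a0]
  · rw [hs _ hi _ h1, a1]
  · rw [hs _ hi _ h2, a2]

/-- A function in the strip space vanishing at all vertices is zero. -/
lemma eq_zero_of_vertices {n : ℕ} (hn : 1 ≤ n) {V : ℕ → E} {s : stripSet V 1 n → ℝ}
    (hs : s ∈ stripSpace V 1 n)
    (h : ∀ j (hj : j ∈ Finset.Icc 1 (n + 2)), s ⟨V j, vertex_mem_stripSet V hn hj⟩ = 0) :
    s = 0 := by
  funext x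
  obtain ⟨i, hi, hx⟩ : ∃ i ∈ Finset.Icc 1 n, (x : E) ∈ tri V i := by
    simpa only [stripSet, Set.mem_iUnion, exists_prop] using x.2
  obtain ⟨f, hf⟩ := hs.2 i hi
  obtain ⟨h0, h1, h2⟩ := vertices_mem_tri V i
  have hi' := Finset.mem_Icc.1 hi
  have hzero : Set.EqOn f (0 : E →ᵃ[ℝ] ℝ) (tri V i) := by
    apply affineMap_eqOn_convexHull
    rintro y (rfl | rfl | rfl)
    · exact (hf ⟨_, _⟩ h0).symm.trans (h i (Finset.mem_Icc.2 (by omega)))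
    · exact (hf ⟨_, _⟩ h1).symm.trans (h (i + 1) (Finset.mem_Icc.2 (by omega)))
    · exact (hf ⟨_, _⟩ h2).symm.trans (h (i + 2) (Finset.mem_Icc.2 (by omega)))
  rw [hf x hx]
  exact hzero hx

/-- On the strip space, vanishing on a side of a triangle means vanishing at its ends. -/
lemma mem_vanishOn_segment_iff {n : ℕ} {V : ℕ → E} {s : stripSet V 1 n → ℝ}
    (hs : s ∈ stripSpace V 1 n) {i : ℕ} (hi : i ∈ Finset.Icc 1 n) {a b : E}
    (ha : a ∈ tri V i) (hb : b ∈ tri V i) :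
    s ∈ vanishOn V 1 n (segment ℝ a b) ↔
      s ⟨a, mem_stripSet_of_mem_tri hi ha⟩ = 0 ∧
      s ⟨b, mem_stripSet_of_mem_tri hi hb⟩ = 0 := by
  refine ⟨fun h => ⟨h _ (left_mem_segment ℝ a b), h _ (right_mem_segment ℝ a b)⟩, ?_⟩
  rintro ⟨h0, h1⟩ x hx
  obtain ⟨f, hf⟩ := hs.2 i hi
  have hzero : Set.EqOn f (0 : E →ᵃ[ℝ] ℝ) (segment ℝ a b) :=
    affineMap_eqOn_segment ((hf ⟨a, _⟩ ha).symm.trans h0) ((hf ⟨b, _⟩ hb).symm.trans h1)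
  rw [hf x ((convex_convexHull ℝ _).segment_subset ha hb hx)]
  exact hzero hx

/-- The subspace of the strip space of functions vanishing at a given set of vertices has
dimension equal to the number of remaining vertices. -/
lemma IsStrip.finrank_eq_card_sdiff {n : ℕ} (hn : 1 ≤ n) {V : ℕ → E} (hV : IsStrip n V)
    (T : Submodule ℝ (stripSet V 1 n → ℝ)) (J : Finset ℕ)
    (hT : ∀ s, s ∈ T ↔ s ∈ stripSpace V 1 n ∧ ∀ j ∈ J, ∀ hj : j ∈ Finset.Icc 1 (n + 2),
      s ⟨V j, vertex_mem_stripSet V hn hj⟩ = 0) :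
    Module.finrank ℝ T = (Finset.Icc 1 (n + 2) \ J).card := by
  let ev : T →ₗ[ℝ] ({j // j ∈ Finset.Icc 1 (n + 2) \ J} → ℝ) :=
    { toFun := fun s j =>
        s.1 ⟨V j, vertex_mem_stripSet V hn (Finset.mem_sdiff.1 j.2).1⟩
      map_add' := fun _ _ => rfl
      map_smul' := fun _ _ => rfl }
  have hinj : Function.Injective ev := by
    rw [injective_iff_map_eq_zero]
    rintro ⟨s, hs⟩ h0
    obtain ⟨hs1, hs2⟩ := (hT s).1 hs
    refine Subtype.ext (eq_zero_of_vertices hn hs1 fun j hj => ?_)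
    by_cases hjJ : j ∈ J
    · exact hs2 j hjJ hj
    · exact congrFun h0 ⟨j, Finset.mem_sdiff.2 ⟨hj, hjJ⟩⟩
  have hsurj : Function.Surjective ev := by
    intro c
    obtain ⟨s, hs, hsc⟩ := hV.exists_interpolating hn
      (fun j => if h : j ∈ Finset.Icc 1 (n + 2) \ J then c ⟨j, h⟩ else 0)
    refine ⟨⟨s, (hT s).2 ⟨hs, fun j hjJ hj => ?_⟩⟩, ?_⟩
    · rw [hsc j hj, dif_neg fun h => (Finset.mem_sdiff.1 h).2 hjJ]
    · funext j
      exact (hsc j (Finset.mem_sdiff.1 j.2).1).trans (dif_pos j.2)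
  rw [(LinearEquiv.ofBijective ev ⟨hinj, hsurj⟩).finrank_eq, Module.finrank_fintype_fun_eq_card,
    Fintype.card_coe]

/-- `dim S(:△̄) = dim S(△̄:) = n` and `dim S(:△̄:) = n - 2`
(the last when `n ≥ 2`), where `S(:△̄)`, `S(△̄:)`, `S(:△̄:)` are the
subspaces of `S(△̄)` of functions vanishing on the left side `[V₁, V₂]`,
on the right side `[V_{n+1}, V_{n+2}]`, resp. on both. -/
theorem dim_boundary_spaces (n : ℕ) (hn : 1 ≤ n) (V : ℕ → E)
    (hV : IsStrip n V) :
    Module.finrank ℝ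
      ↥(stripSpace V 1 n ⊓ vanishOn V 1 n (segment ℝ (V 1) (V 2))) = n ∧
    Module.finrank ℝ
      ↥(stripSpace V 1 n ⊓
        vanishOn V 1 n (segment ℝ (V (n + 1)) (V (n + 2)))) = n ∧
    (2 ≤ n → Module.finrank ℝ
      ↥(stripSpace V 1 n ⊓ vanishOn V 1 n (segment ℝ (V 1) (V 2)) ⊓
        vanishOn V 1 n (segment ℝ (V (n + 1)) (V (n + 2)))) = n - 2) := by
  have h1 : 1 ∈ Finset.Icc 1 n := Finset.mem_Icc.2 ⟨le_rfl, hn⟩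
  have hnn : n ∈ Finset.Icc 1 n := Finset.mem_Icc.2 ⟨hn, le_rfl⟩
  have hleft : ∀ s ∈ stripSpace V 1 n, s ∈ vanishOn V 1 n (segment ℝ (V 1) (V 2)) ↔
      ∀ j ∈ ({1, 2} : Finset ℕ), ∀ hj : j ∈ Finset.Icc 1 (n + 2),
        s ⟨V j, vertex_mem_stripSet V hn hj⟩ = 0 := by
    intro s hs
    rw [mem_vanishOn_segment_iff hs h1 (vertices_mem_tri V 1).1 (vertices_mem_tri V 1).2.1]
    simp
  have hright : ∀ s ∈ stripSpace V 1 n,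
      s ∈ vanishOn V 1 n (segment ℝ (V (n + 1)) (V (n + 2))) ↔
      ∀ j ∈ ({n + 1, n + 2} : Finset ℕ), ∀ hj : j ∈ Finset.Icc 1 (n + 2),
        s ⟨V j, vertex_mem_stripSet V hn hj⟩ = 0 := by
    intro s hs
    rw [mem_vanishOn_segment_iff hs hnn (vertices_mem_tri V n).2.1 (vertices_mem_tri V n).2.2]
    simp
  refine ⟨?_, ?_, fun hn2 => ?_⟩
  · rw [hV.finrank_eq_card_sdiff hn _ {1, 2} fun s => by
      rw [Submodule.mem_inf]; exact and_congr_right (hleft s)]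
    rw [Finset.card_sdiff_of_subset (by intro j; simp; omega), Finset.card_pair (by omega)]
    simp
  · rw [hV.finrank_eq_card_sdiff hn _ {n + 1, n + 2} fun s => by
      rw [Submodule.mem_inf]; exact and_congr_right (hright s)]
    rw [Finset.card_sdiff_of_subset (by intro j; simp; omega), Finset.card_pair (by omega)]
    simp
  · rw [hV.finrank_eq_card_sdiff hn _ ({1, 2} ∪ {n + 1, n + 2}) fun s => by
      rw [inf_assoc, Submodule.mem_inf, Submodule.mem_inf]
      refine and_congr_right fun hs => ?_
      rw [hleft s hs, hright s hs, Finset.forall_mem_union]]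
    rw [Finset.card_sdiff_of_subset (by intro j; simp; omega),
      Finset.card_union_of_disjoint (by simp [Finset.disjoint_left]; omega),
      Finset.card_pair (by omega), Finset.card_pair (by omega), Nat.card_Icc]
    omega
end
end

section
/- Let {△̄, A} be an exact interpolation problem on a strip of n triangles. If some three successive triangles Δₖ, Δₖ₊₁, Δₖ₊₂ contain no nodes of A, then {△̄, A} is not poised. Likewise, if the first triangle Δ₁ or the last triangle Δₙ contains no node of A, then {△̄, A} is not poised. -/
open scoped Classical

noncomputable section

/-- An affine function on the plane is determined freely by its values at three affinely
independent points. -/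
lemma exists_affineMap_eq_at_triangle {P Q R : E} (h : AffineIndependent ℝ ![P, Q, R])
    (p q r : ℝ) : ∃ f : E →ᵃ[ℝ] ℝ, f P = p ∧ f Q = q ∧ f R = r := by
  have htop : affineSpan ℝ (Set.range ![P, Q, R]) = ⊤ := by
    rw [h.affineSpan_eq_top_iff_card_eq_finrank_add_one]
    simp
  let b : AffineBasis (Fin 3) ℝ E := ⟨![P, Q, R], h, htop⟩
  have hP : P = b 0 := rfl
  have hQ : Q = b 1 := rfl
  have hR : R = b 2 := rfl
  refine ⟨p • b.coord 0 + q • b.coord 1 + r • b.coord 2, ?_, ?_, ?_⟩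
  · rw [hP]; simp
  · rw [hQ]; simp
  · rw [hR]; simp

lemma isClosed_tri (V : ℕ → E) (i : ℕ) : IsClosed (tri V i) :=
  (Set.toFinite _).isClosed_convexHull ℝ

lemma vertex_mem_tri (V : ℕ → E) {i j : ℕ} (hij : i ≤ j) (hji : j ≤ i + 2) : V j ∈ tri V i := by
  apply subset_convexHull
  obtain rfl | rfl | rfl : j = i ∨ j = i + 1 ∨ j = i + 2 := by omega
  all_goals simp

lemma tri_subset_stripSet (V : ℕ → E) {k m i : ℕ} (hi : i ∈ Finset.Icc k m) :
    tri V i ⊆ stripSet V k m :=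
  Set.subset_biUnion_of_mem (u := fun i => tri V i) hi

/-- Affine functions on two triangles of a strip with matching values at the vertices agree on
the intersection of the triangles. -/
lemma IsStrip.eq_on_inter {n : ℕ} {V : ℕ → E} (hV : IsStrip n V) {v : ℕ → ℝ}
    {F : ℕ → E →ᵃ[ℝ] ℝ}
    (hF : ∀ i ∈ Finset.Icc 1 n, ∀ j, i ≤ j → j ≤ i + 2 → F i (V j) = v j)
    {i l : ℕ} (hi : i ∈ Finset.Icc 1 n) (hl : l ∈ Finset.Icc 1 n) {x : E}
    (hxi : x ∈ tri V i) (hxl : x ∈ tri V l) : F i x = F l x := by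
  wlog hil : i ≤ l generalizing i l
  · exact (this hl hi hxl hxi (by omega)).symm
  obtain ⟨hi1, hin⟩ := Finset.mem_Icc.1 hi
  obtain ⟨hl1, hln⟩ := Finset.mem_Icc.1 hl
  obtain rfl | rfl | rfl | hlt : l = i ∨ l = i + 1 ∨ l = i + 2 ∨ i + 3 ≤ l := by omega
  · rfl
  · have hx : x ∈ segment ℝ (V (i + 1)) (V (i + 2)) := hV.adj i hi1 hln ▸ ⟨hxi, hxl⟩
    rw [segment_eq_image_lineMap] at hx
    obtain ⟨t, -, rfl⟩ := hx
    simp only [AffineMap.apply_lineMap]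
    rw [hF i hi _ (by omega) (by omega), hF i hi _ (by omega) (by omega),
      hF (i + 1) hl _ (by omega) (by omega), hF (i + 1) hl _ (by omega) (by omega)]
  · have hx : x ∈ ({V (i + 2)} : Set E) := hV.touch i hi1 hln ▸ ⟨hxi, hxl⟩
    obtain rfl := Set.mem_singleton_iff.1 hx
    rw [hF i hi _ (by omega) (by omega), hF (i + 2) hl _ (by omega) (by omega)]
  · have hx : x ∈ (∅ : Set E) := hV.disj i l hi1 hln hlt ▸ ⟨hxi, hxl⟩
    exact hx.elim

/-- Arbitrary vertex values are attained by a continuous piecewise affine function. -/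
lemma IsStrip.exists_stripSpace_of_vertex_values {n : ℕ} {V : ℕ → E} (hV : IsStrip n V)
    (v : ℕ → ℝ) : ∃ s ∈ stripSpace V 1 n, ∀ i ∈ Finset.Icc 1 n, ∃ f : E →ᵃ[ℝ] ℝ,
      (∀ x : stripSet V 1 n, (x : E) ∈ tri V i → s x = f x) ∧
      ∀ j, i ≤ j → j ≤ i + 2 → f (V j) = v j := by
  have hex : ∀ i, ∃ f : E →ᵃ[ℝ] ℝ,
      i ∈ Finset.Icc 1 n → ∀ j, i ≤ j → j ≤ i + 2 → f (V j) = v j := by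
    intro i
    by_cases hi : i ∈ Finset.Icc 1 n
    · obtain ⟨hi1, hin⟩ := Finset.mem_Icc.1 hi
      obtain ⟨f, h0, h1, h2⟩ := exists_affineMap_eq_at_triangle (hV.indep i hi1 hin)
        (v i) (v (i + 1)) (v (i + 2))
      refine ⟨f, fun _ j hij hji => ?_⟩
      obtain rfl | rfl | rfl : j = i ∨ j = i + 1 ∨ j = i + 2 := by omega
      all_goals assumption
    · exact ⟨0, fun h => (hi h).elim⟩
  choose F hF using hex
  have hcover : ∀ x : stripSet V 1 n, ∃ i, i ∈ Finset.Icc 1 n ∧ (x : E) ∈ tri V i := by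
    intro x
    simpa only [stripSet, Set.mem_iUnion, exists_prop] using x.2
  choose idx hidx hmem using hcover
  let s : stripSet V 1 n → ℝ := fun x => F (idx x) x
  have hs : ∀ i ∈ Finset.Icc 1 n, ∀ x : stripSet V 1 n, (x : E) ∈ tri V i → s x = F i x :=
    fun i hi x hx => hV.eq_on_inter hF (hidx x) hi (hmem x) hx
  refine ⟨s, ⟨?_, fun i hi => ⟨F i, hs i hi⟩⟩, fun i hi => ⟨F i, hs i hi, hF i hi⟩⟩
  refine LocallyFinite.continuous
    (f := fun i : Finset.Icc 1 n => (Subtype.val ⁻¹' tri V i : Set (stripSet V 1 n)))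
    (locallyFinite_of_finite _) ?_ (fun i => (isClosed_tri V i).preimage continuous_subtype_val) ?_
  · exact Set.eq_univ_of_forall fun x => Set.mem_iUnion.2 ⟨⟨idx x, hidx x⟩, hmem x⟩
  · intro i
    exact (((F i).continuous_of_finiteDimensional).comp
      continuous_subtype_val).continuousOn.congr (hs i i.2)

/-- If no node lies in a triangle having `V j` as a vertex, the problem is not poised: the hat
function at `V j` vanishes at all the nodes. -/
lemma IsStrip.not_poised_of_empty_star {n : ℕ} {V : ℕ → E} (hV : IsStrip n V) {A : Finset E}
    {i j : ℕ} (hi : i ∈ Finset.Icc 1 n) (hij : i ≤ j) (hji : j ≤ i + 2)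
    (hempty : ∀ l ∈ Finset.Icc 1 n, l ≤ j → j ≤ l + 2 → ∀ a ∈ A, a ∉ tri V l) :
    ¬ Poised V 1 n A := by
  intro hp
  obtain ⟨s, hs, hsF⟩ := hV.exists_stripSpace_of_vertex_values (Pi.single j 1)
  have hzero : ∀ a : stripSet V 1 n, (a : E) ∈ A → s a = 0 := by
    intro a ha
    obtain ⟨l, hl, hal⟩ : ∃ l, l ∈ Finset.Icc 1 n ∧ (a : E) ∈ tri V l := by
      simpa only [stripSet, Set.mem_iUnion, exists_prop] using a.2
    have hj : ¬ (l ≤ j ∧ j ≤ l + 2) := fun h => hempty l hl h.1 h.2 a ha hal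
    obtain ⟨f, hf, hfv⟩ := hsF l hl
    rw [hf a hal]
    refine convexHull_min ?_ ((convex_singleton (0 : ℝ)).affine_preimage f) hal
    have hvert : ∀ m, l ≤ m → m ≤ l + 2 → V m ∈ f ⁻¹' {0} := by
      intro m hlm hml
      rw [Set.mem_preimage, hfv m hlm hml, Pi.single_eq_of_ne (by rintro rfl; exact hj ⟨hlm, hml⟩)]
      rfl
    rintro _ (rfl | rfl | rfl) <;> exact hvert _ (by omega) (by omega)
  have hs0 : s = 0 := (hp 0).unique ⟨hs, hzero⟩ ⟨Submodule.zero_mem _, fun _ _ => rfl⟩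
  have hVj : V j ∈ tri V i := vertex_mem_tri V hij hji
  obtain ⟨f, hf, hfv⟩ := hsF i hi
  have h1 := hf ⟨V j, tri_subset_stripSet V hi hVj⟩ hVj
  rw [hfv j hij hji, hs0] at h1
  simp at h1

/-- an exact problem `{△̄, A}` is not poised if three
successive triangles contain no nodes, and likewise if the first or the
last triangle contains no node. -/
theorem not_poised_of_empty_triangles (n : ℕ) (hn : 1 ≤ n) (V : ℕ → E)
    (hV : IsStrip n V) (A : Finset E) (hA : ↑A ⊆ stripSet V 1 n)
    (hexact : A.card = n + 2) :
    (∀ k, 1 ≤ k → k + 2 ≤ n →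
      (∀ a ∈ A, a ∉ tri V k ∧ a ∉ tri V (k + 1) ∧ a ∉ tri V (k + 2)) →
      ¬ Poised V 1 n A) ∧
    ((∀ a ∈ A, a ∉ tri V 1) → ¬ Poised V 1 n A) ∧
    ((∀ a ∈ A, a ∉ tri V n) → ¬ Poised V 1 n A) := by
  refine ⟨fun k hk hkn h => ?_, fun h => ?_, fun h => ?_⟩
  · refine hV.not_poised_of_empty_star (i := k) (j := k + 2) (Finset.mem_Icc.2 ⟨hk, by omega⟩)
      (by omega) le_rfl fun l _ hlj hjl a ha => ?_
    obtain ⟨h0, h1, h2⟩ := h a ha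
    obtain rfl | rfl | rfl : l = k ∨ l = k + 1 ∨ l = k + 2 := by omega
    all_goals assumption
  · refine hV.not_poised_of_empty_star (i := 1) (j := 1) (Finset.mem_Icc.2 ⟨le_rfl, hn⟩)
      le_rfl (by omega) fun l hl hlj _ a ha => ?_
    obtain rfl : l = 1 := le_antisymm hlj (Finset.mem_Icc.1 hl).1
    exact h a ha
  · refine hV.not_poised_of_empty_star (i := n) (j := n + 2) (Finset.mem_Icc.2 ⟨hn, le_rfl⟩)
      (by omega) le_rfl fun l hl _ hjl a ha => ?_
    obtain rfl : l = n := le_antisymm (Finset.mem_Icc.1 hl).2 (by omega)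
    exact h a ha
end
end
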